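/- arXiv:2411.19614 — 5 statements merged into one kernel-verified Lean document; each statement's English description precedes it below -/
import Mathlib

section
/- Let V be a real vector space, a : V × V → ℝ a symmetric positive semidefinite bilinear form with induced energy seminorm ‖v‖_A := (a(v,v))^{1/2}, W ⊆ V a linear subspace, and C, C_k : V → V linear maps whose ranges are contained in W. Assume the a-orthogonality a(v − C v, w) = 0 for all v ∈ V and all w ∈ W. Then for every v ∈ V, writing v^ms := v − C_k v, one has a(v^ms, v) ≤ a(v^ms, v^ms) + ‖(C − C_k)v‖_A · ‖C_k v‖_A. If in addition ‖C_k v‖_A ≤ ‖v‖_A, then a(v^ms, v) ≤ a(v^ms, v^ms) + ‖(C − C_k)v‖_A · ‖v‖_A. -/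
/-- Cauchy–Schwarz inequality for a symmetric positive semidefinite bilinear form, stated for the
induced seminorm. -/
theorem LinearMap.apply_le_sqrt_mul_sqrt {V : Type*} [AddCommGroup V] [Module ℝ V]
    (a : V →ₗ[ℝ] V →ₗ[ℝ] ℝ) (ha : ∀ v w, a v w = a w v) (hpsd : ∀ v, 0 ≤ a v v) (x y : V) :
    a x y ≤ √(a x x) * √(a y y) := by
  rw [← Real.sqrt_mul (hpsd x)]
  apply Real.le_sqrt_of_sq_le
  have h := LinearMap.BilinForm.apply_mul_apply_le_of_forall_zero_le a hpsd x y
  rwa [ha y x, ← sq] at h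

/-- With the energy seminorm `‖v‖_A := √(a(v,v))`, the a-orthogonality of the
ideal corrector `C` (with range in the fine-scale space `W`) gives, for `v^ms := v − C_k v`,
`a(v^ms, v) ≤ a(v^ms, v^ms) + ‖(C − C_k)v‖_A ‖C_k v‖_A`, and under the stability
`‖C_k v‖_A ≤ ‖v‖_A` also `a(v^ms, v) ≤ a(v^ms, v^ms) + ‖(C − C_k)v‖_A ‖v‖_A`. -/
theorem stmt_3 {V : Type*} [AddCommGroup V] [Module ℝ V]
    (a : V →ₗ[ℝ] V →ₗ[ℝ] ℝ)
    (ha : ∀ v w, a v w = a w v) (hpsd : ∀ v, 0 ≤ a v v)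
    (W : Submodule ℝ V) (C Ck : V →ₗ[ℝ] V)
    (hC : ∀ v, C v ∈ W) (hCk : ∀ v, Ck v ∈ W)
    (horth : ∀ v : V, ∀ w ∈ W, a (v - C v) w = 0) :
    ∀ v : V,
      a (v - Ck v) v ≤ a (v - Ck v) (v - Ck v) +
        Real.sqrt (a (C v - Ck v) (C v - Ck v)) * Real.sqrt (a (Ck v) (Ck v)) ∧
      (Real.sqrt (a (Ck v) (Ck v)) ≤ Real.sqrt (a v v) →
        a (v - Ck v) v ≤ a (v - Ck v) (v - Ck v) +
          Real.sqrt (a (C v - Ck v) (C v - Ck v)) * Real.sqrt (a v v)) := by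
  intro v
  have h_fine : a (v - Ck v) v - a (v - Ck v) (v - Ck v) = a (C v - Ck v) (Ck v) := by
    have h := horth v (Ck v) (hCk v)
    simp only [map_sub, LinearMap.sub_apply] at h ⊢
    linarith
  have h_cs := a.apply_le_sqrt_mul_sqrt ha hpsd (C v - Ck v) (Ck v)
  refine ⟨by linarith, fun h_stab => ?_⟩
  have h_mono := mul_le_mul_of_nonneg_left h_stab (Real.sqrt_nonneg (a (C v - Ck v) (C v - Ck v)))
  linarith
end

section
/- Let V be a real vector space, a : V × V → ℝ a symmetric positive semidefinite bilinear form with induced energy seminorm ‖v‖_A := (a(v,v))^{1/2}, m : V × V → ℝ a symmetric bilinear form, W ⊆ V a linear subspace, and C, C_k : V → V linear maps whose ranges are contained in W. Assume a(v − C v, w) = 0 for all v ∈ V, w ∈ W, and ‖C_k v‖_A ≤ ‖v‖_A for all v ∈ V. Let λ ∈ ℝ and u ∈ V satisfy a(u, w) = λ m(u, w) for all w ∈ V. Let v_H ∈ V with v^ms := v_H − C_k v_H, m(v^ms, v^ms) = 1 and m(v_H, v_H) ≠ 0, and set ã := a(v^ms, v_H). Then ã / m(v_H, v_H) − λ ≤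 [a(u − v^ms, u − v^ms) − λ m(u − v^ms, u − v^ms)] + ‖(C − C_k)v_H‖_A · ‖v_H‖_A + (ã / m(v_H, v_H)) · (m(v^ms, v^ms) − m(v_H, v_H)). -/
/-- Cauchy–Schwarz inequality for a symmetric positive semidefinite bilinear form, in terms of
the induced seminorm. -/
theorem bilin_apply_le_sqrt_mul_sqrt {V : Type*} [AddCommGroup V] [Module ℝ V]
    (a : V →ₗ[ℝ] V →ₗ[ℝ] ℝ) (ha : ∀ v w, a v w = a w v) (hpsd : ∀ v, 0 ≤ a v v) (x y : V) :
    a x y ≤ Real.sqrt (a x x) * Real.sqrt (a y y) := by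
  rw [← Real.sqrt_mul (hpsd x)]
  apply Real.le_sqrt_of_sq_le
  have h := LinearMap.BilinForm.apply_mul_apply_le_of_forall_zero_le a hpsd x y
  rwa [ha y x, ← sq] at h

/-- For an eigenpair `(lam, u)`, the residual form of the error `u - v` is the residual form
of `v`. -/
theorem eigenpair_residual_sub {V : Type*} [AddCommGroup V] [Module ℝ V]
    (a m : V →ₗ[ℝ] V →ₗ[ℝ] ℝ) (ha : ∀ v w, a v w = a w v) (hm : ∀ v w, m v w = m w v)
    (lam : ℝ) (u : V) (heig : ∀ w, a u w = lam * m u w) (v : V) :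
    a (u - v) (u - v) - lam * m (u - v) (u - v) = a v v - lam * m v v := by
  simp only [map_sub, LinearMap.sub_apply, ha v u, hm v u, heig]
  ring

/-- For an eigenpair `(λ, u)` and a coarse function `v_H` with multiscale
modification `v^ms := v_H − C_k v_H` normalized so that `m(v^ms, v^ms) = 1`, setting
`ã := a(v^ms, v_H)`, the modified LOD Rayleigh quotient satisfies
`ã/m(v_H,v_H) − λ ≤ [a(u − v^ms, u − v^ms) − λ m(u − v^ms, u − v^ms)]
  + ‖(C − C_k)v_H‖_A ‖v_H‖_A + (ã/m(v_H,v_H))(m(v^ms,v^ms) − m(v_H,v_H))`. -/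
theorem stmt_4 {V : Type*} [AddCommGroup V] [Module ℝ V]
    (a m : V →ₗ[ℝ] V →ₗ[ℝ] ℝ)
    (ha : ∀ v w, a v w = a w v) (hpsd : ∀ v, 0 ≤ a v v)
    (hm : ∀ v w, m v w = m w v)
    (W : Submodule ℝ V) (C Ck : V →ₗ[ℝ] V)
    (hC : ∀ v, C v ∈ W) (hCk : ∀ v, Ck v ∈ W)
    (horth : ∀ v : V, ∀ w ∈ W, a (v - C v) w = 0)
    (hstab : ∀ v : V, Real.sqrt (a (Ck v) (Ck v)) ≤ Real.sqrt (a v v))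
    (lam : ℝ) (u : V) (heig : ∀ w, a u w = lam * m u w)
    (vH : V) (hnorm : m (vH - Ck vH) (vH - Ck vH) = 1) (hm0 : m vH vH ≠ 0) :
    a (vH - Ck vH) vH / m vH vH - lam ≤
      (a (u - (vH - Ck vH)) (u - (vH - Ck vH)) -
        lam * m (u - (vH - Ck vH)) (u - (vH - Ck vH))) +
      Real.sqrt (a (C vH - Ck vH) (C vH - Ck vH)) * Real.sqrt (a vH vH) +
      (a (vH - Ck vH) vH / m vH vH) * (m (vH - Ck vH) (vH - Ck vH) - m vH vH) := by
  have hconsistency : a (vH - Ck vH) (Ck vH) ≤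
      Real.sqrt (a (C vH - Ck vH) (C vH - Ck vH)) * Real.sqrt (a vH vH) := by
    have hsplit : a (vH - Ck vH) (Ck vH) = a (C vH - Ck vH) (Ck vH) := by
      have h := horth vH (Ck vH) (hCk vH)
      simp only [map_sub, LinearMap.sub_apply] at h ⊢
      linarith
    rw [hsplit]
    exact (bilin_apply_le_sqrt_mul_sqrt a ha hpsd _ _).trans
      (mul_le_mul_of_nonneg_left (hstab vH) (Real.sqrt_nonneg _))
  have hdiag : a (vH - Ck vH) (vH - Ck vH) = a (vH - Ck vH) vH - a (vH - Ck vH) (Ck vH) :=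
    map_sub _ _ _
  rw [eigenpair_residual_sub a m ha hm lam u heig, hnorm, mul_sub, div_mul_cancel₀ _ hm0]
  linarith
end

section
/- Let V be a real vector space, a : V × V → ℝ a symmetric positive semidefinite bilinear form with induced energy seminorm ‖v‖_A := (a(v,v))^{1/2}, m : V × V → ℝ a symmetric bilinear form, W ⊆ V a linear subspace, and C, C_k : V → V linear maps whose ranges are contained in W. Assume there are constants δ ≥ 0 and g ≥ 0 such that |m(v, w)| ≤ δ‖v‖_A‖w‖_A for all v ∈ V and w ∈ W, ‖C v‖_A ≤ ‖v‖_A for all v ∈ V, and ‖(C − C_k)v‖_A ≤ g‖v‖_A for all v ∈ V. Then for all v1, v2 ∈ V, |m(v1 − C_k v1, v2 − C_k v2) − m(v1, v2)| ≤ δ(3 + 4g + g²)‖v1‖_A‖v2‖_A. -/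
/-- The triangle inequality for the seminorm induced by a positive semidefinite symmetric
bilinear form. -/
theorem sqrt_apply_sub_le {V : Type*} [AddCommGroup V] [Module ℝ V]
    (a : V →ₗ[ℝ] V →ₗ[ℝ] ℝ) (ha : ∀ v w, a v w = a w v) (hpsd : ∀ v, 0 ≤ a v v) (x y : V) :
    Real.sqrt (a (x - y) (x - y)) ≤ Real.sqrt (a x x) + Real.sqrt (a y y) := by
  have hcs : a x y * a y x ≤ a x x * a y y :=
    LinearMap.BilinForm.apply_mul_apply_le_of_forall_zero_le a hpsd x y
  have habs : |a x y| ≤ Real.sqrt (a x x) * Real.sqrt (a y y) := by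
    rw [← Real.sqrt_mul (hpsd x)]
    apply Real.abs_le_sqrt
    rwa [← ha x y, ← pow_two] at hcs
  refine Real.sqrt_le_iff.mpr ⟨by positivity, ?_⟩
  simp only [map_sub, LinearMap.sub_apply]
  rw [ha y x]
  nlinarith [Real.sq_sqrt (hpsd x), Real.sq_sqrt (hpsd y), neg_abs_le (a x y)]

/-- If the mass form is small on the fine-scale space `W`
(`|m(v,w)| ≤ δ‖v‖_A‖w‖_A` for `w ∈ W`), the ideal corrector `C` is stable and the
localization error satisfies `‖(C − C_k)v‖_A ≤ g‖v‖_A`, then the localized LOD mass form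
`m((1 − C_k)v1, (1 − C_k)v2)` deviates from the plain mass form `m(v1, v2)` by at most
`δ(3 + 4g + g²)‖v1‖_A‖v2‖_A`. -/
theorem stmt_5 {V : Type*} [AddCommGroup V] [Module ℝ V]
    (a m : V →ₗ[ℝ] V →ₗ[ℝ] ℝ)
    (ha : ∀ v w, a v w = a w v) (hpsd : ∀ v, 0 ≤ a v v)
    (hm : ∀ v w, m v w = m w v)
    (W : Submodule ℝ V) (C Ck : V →ₗ[ℝ] V)
    (hC : ∀ v, C v ∈ W) (hCk : ∀ v, Ck v ∈ W)
    (δ g : ℝ) (hδ : 0 ≤ δ) (hg : 0 ≤ g)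
    (hmsmall : ∀ v : V, ∀ w ∈ W,
      |m v w| ≤ δ * Real.sqrt (a v v) * Real.sqrt (a w w))
    (hCstab : ∀ v : V, Real.sqrt (a (C v) (C v)) ≤ Real.sqrt (a v v))
    (hloc : ∀ v : V, Real.sqrt (a (C v - Ck v) (C v - Ck v)) ≤ g * Real.sqrt (a v v)) :
    ∀ v1 v2 : V,
      |m (v1 - Ck v1) (v2 - Ck v2) - m v1 v2| ≤
        δ * (3 + 4 * g + g ^ 2) * Real.sqrt (a v1 v1) * Real.sqrt (a v2 v2) := by
  have hbound (v : V) : Real.sqrt (a (Ck v) (Ck v)) ≤ (1 + g) * Real.sqrt (a v v) := by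
    have h := sqrt_apply_sub_le a ha hpsd (C v) (C v - Ck v)
    rw [sub_sub_cancel] at h
    linarith [hCstab v, hloc v]
  intro v1 v2
  have hexp : m (v1 - Ck v1) (v2 - Ck v2) - m v1 v2 =
      m (Ck v1) (Ck v2) - m v1 (Ck v2) - m v2 (Ck v1) := by
    simp only [map_sub, LinearMap.sub_apply]
    rw [hm v2 (Ck v1)]
    ring
  have h12 : |m v1 (Ck v2)| ≤
      δ * Real.sqrt (a v1 v1) * ((1 + g) * Real.sqrt (a v2 v2)) :=
    (hmsmall v1 _ (hCk v2)).trans (by gcongr; exact hbound v2)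
  have h21 : |m v2 (Ck v1)| ≤
      δ * Real.sqrt (a v2 v2) * ((1 + g) * Real.sqrt (a v1 v1)) :=
    (hmsmall v2 _ (hCk v1)).trans (by gcongr; exact hbound v1)
  have hkk : |m (Ck v1) (Ck v2)| ≤
      δ * ((1 + g) * Real.sqrt (a v1 v1)) * ((1 + g) * Real.sqrt (a v2 v2)) :=
    (hmsmall _ _ (hCk v2)).trans (by gcongr; exacts [hbound v1, hbound v2])
  calc |m (v1 - Ck v1) (v2 - Ck v2) - m v1 v2|
      ≤ |m (Ck v1) (Ck v2)| + |m v1 (Ck v2)| + |m v2 (Ck v1)| := by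
        rw [hexp]
        exact (abs_sub _ _).trans (add_le_add_left (abs_sub _ _) _)
    _ ≤ δ * ((1 + g) * Real.sqrt (a v1 v1)) * ((1 + g) * Real.sqrt (a v2 v2)) +
        δ * Real.sqrt (a v1 v1) * ((1 + g) * Real.sqrt (a v2 v2)) +
        δ * Real.sqrt (a v2 v2) * ((1 + g) * Real.sqrt (a v1 v1)) := by gcongr
    _ = δ * (3 + 4 * g + g ^ 2) * Real.sqrt (a v1 v1) * Real.sqrt (a v2 v2) := by ring
end

section
/- Let V be a real vector space, a : V × V → ℝ a symmetric positive semidefinite bilinear form with induced energy seminorm ‖v‖_A := (a(v,v))^{1/2}, W ⊆ V a linear subspace, and C, C_k : V → V linear maps whose ranges are contained in W. Assume a(v − C v, w) = 0 for all v ∈ V, w ∈ W, ‖C v‖_A ≤ ‖v‖_A for all v ∈ V, and ‖(C − C_k)v‖_A ≤ g‖v‖_A for all v ∈ V with a constant g ≥ 0. Then for all v1, v2 ∈ V, |a(v1 − C_k v1, v2 − C_k v2) − a(v1 − C_k v1, v2)| ≤ g(2 + g)‖v1‖_A‖v2‖_A. -/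
/-- The Cauchy–Schwarz inequality for a symmetric positive semidefinite bilinear form, in terms
of the induced seminorm. -/
theorem abs_apply_le_sqrt_mul_sqrt {V : Type*} [AddCommGroup V] [Module ℝ V]
    (a : V →ₗ[ℝ] V →ₗ[ℝ] ℝ) (ha : ∀ v w, a v w = a w v) (hpsd : ∀ v, 0 ≤ a v v) (x y : V) :
    |a x y| ≤ Real.sqrt (a x x) * Real.sqrt (a y y) := by
  rw [← Real.sqrt_mul (hpsd x)]
  apply Real.abs_le_sqrt
  have h := LinearMap.BilinForm.apply_mul_apply_le_of_forall_zero_le a hpsd x y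
  rwa [ha y x, ← sq] at h

/-- Under a-orthogonality of the ideal corrector `C`, its stability
`‖C v‖_A ≤ ‖v‖_A` and the localization error bound `‖(C − C_k)v‖_A ≤ g‖v‖_A`, the Galerkin
LOD stiffness form `a((1 − C_k)v1, (1 − C_k)v2)` deviates from the Petrov–Galerkin LOD
stiffness form `a((1 − C_k)v1, v2)` by at most `g(2 + g)‖v1‖_A‖v2‖_A`. -/
theorem stmt_6 {V : Type*} [AddCommGroup V] [Module ℝ V]
    (a : V →ₗ[ℝ] V →ₗ[ℝ] ℝ)
    (ha : ∀ v w, a v w = a w v) (hpsd : ∀ v, 0 ≤ a v v)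
    (W : Submodule ℝ V) (C Ck : V →ₗ[ℝ] V)
    (hC : ∀ v, C v ∈ W) (hCk : ∀ v, Ck v ∈ W)
    (horth : ∀ v : V, ∀ w ∈ W, a (v - C v) w = 0)
    (hCstab : ∀ v : V, Real.sqrt (a (C v) (C v)) ≤ Real.sqrt (a v v))
    (g : ℝ) (hg : 0 ≤ g)
    (hloc : ∀ v : V, Real.sqrt (a (C v - Ck v) (C v - Ck v)) ≤ g * Real.sqrt (a v v)) :
    ∀ v1 v2 : V,
      |a (v1 - Ck v1) (v2 - Ck v2) - a (v1 - Ck v1) v2| ≤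
        g * (2 + g) * Real.sqrt (a v1 v1) * Real.sqrt (a v2 v2) := by
  intro v₁ v₂
  have key : a (v₁ - Ck v₁) (v₂ - Ck v₂) - a (v₁ - Ck v₁) v₂ =
      a (C v₁ - Ck v₁) (C v₂ - Ck v₂) - a (C v₁ - Ck v₁) (C v₂) := by
    have h := horth v₁ (Ck v₂) (hCk v₂)
    simp only [map_sub, LinearMap.sub_apply] at h ⊢
    linarith
  have h₁ : |a (C v₁ - Ck v₁) (C v₂ - Ck v₂)| ≤
      (g * Real.sqrt (a v₁ v₁)) * (g * Real.sqrt (a v₂ v₂)) :=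
    (abs_apply_le_sqrt_mul_sqrt a ha hpsd _ _).trans (by gcongr <;> exact hloc _)
  have h₂ : |a (C v₁ - Ck v₁) (C v₂)| ≤ (g * Real.sqrt (a v₁ v₁)) * Real.sqrt (a v₂ v₂) :=
    (abs_apply_le_sqrt_mul_sqrt a ha hpsd _ _).trans
      (mul_le_mul (hloc _) (hCstab _) (Real.sqrt_nonneg _) (by positivity))
  have h₃ : 0 ≤ g * Real.sqrt (a v₁ v₁) * Real.sqrt (a v₂ v₂) := by positivity
  rw [key]
  linarith [abs_sub (a (C v₁ - Ck v₁) (C v₂ - Ck v₂)) (a (C v₁ - Ck v₁) (C v₂))]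
end

section
/- Let V be a real vector space, a : V × V → ℝ a symmetric positive semidefinite bilinear form with induced energy seminorm ‖v‖_A := (a(v,v))^{1/2}, m : V × V → ℝ a symmetric bilinear form, W ⊆ V a linear subspace, and C, C_k, Ĉ : V → V linear maps whose ranges are contained in W. Assume |m(v, w)| ≤ δ‖v‖_A‖w‖_A for all v ∈ V and w ∈ W, ‖C v‖_A ≤ ‖v‖_A, ‖(C − C_k)v‖_A ≤ g‖v‖_A, and ‖(C_k − Ĉ)v‖_A ≤ η‖v‖_A for all v ∈ V, with constants δ, g, η ≥ 0. Then for every v ∈ V, |m(v − Ĉ v, v − Ĉ v) − m(v, v)| ≤ δ(‖Ĉ v‖_A² + 2‖Ĉ v‖_A‖v‖_A) ≤ δ(1 + g + η)(3 + g + η)‖v‖_A². -/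
/-- With the mass form small on `W`, the ideal corrector `C` stable, the
localization error `‖(C − C_k)v‖_A ≤ g‖v‖_A` and the offline–online corrector error
`‖(C_k − Ĉ)v‖_A ≤ η‖v‖_A`, one has for every `v`
`|m(v − Ĉv, v − Ĉv) − m(v,v)| ≤ δ(‖Ĉv‖_A² + 2‖Ĉv‖_A‖v‖_A) ≤ δ(1+g+η)(3+g+η)‖v‖_A²`. -/
theorem stmt_7 {V : Type*} [AddCommGroup V] [Module ℝ V]
    (a m : V →ₗ[ℝ] V →ₗ[ℝ] ℝ)
    (ha : ∀ v w, a v w = a w v) (hpsd : ∀ v, 0 ≤ a v v)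
    (hm : ∀ v w, m v w = m w v)
    (W : Submodule ℝ V) (C Ck Chat : V →ₗ[ℝ] V)
    (hC : ∀ v, C v ∈ W) (hCk : ∀ v, Ck v ∈ W) (hChat : ∀ v, Chat v ∈ W)
    (δ g η : ℝ) (hδ : 0 ≤ δ) (hg : 0 ≤ g) (hη : 0 ≤ η)
    (hmsmall : ∀ v : V, ∀ w ∈ W,
      |m v w| ≤ δ * Real.sqrt (a v v) * Real.sqrt (a w w))
    (hCstab : ∀ v : V, Real.sqrt (a (C v) (C v)) ≤ Real.sqrt (a v v))
    (hloc : ∀ v : V, Real.sqrt (a (C v - Ck v) (C v - Ck v)) ≤ g * Real.sqrt (a v v))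
    (hoo : ∀ v : V,
      Real.sqrt (a (Ck v - Chat v) (Ck v - Chat v)) ≤ η * Real.sqrt (a v v)) :
    ∀ v : V,
      |m (v - Chat v) (v - Chat v) - m v v| ≤
        δ * (Real.sqrt (a (Chat v) (Chat v)) ^ 2 +
          2 * Real.sqrt (a (Chat v) (Chat v)) * Real.sqrt (a v v)) ∧
      δ * (Real.sqrt (a (Chat v) (Chat v)) ^ 2 +
          2 * Real.sqrt (a (Chat v) (Chat v)) * Real.sqrt (a v v)) ≤
        δ * (1 + g + η) * (3 + g + η) * Real.sqrt (a v v) ^ 2 := by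
  intro v
  constructor
  · have hexp : m (v - Chat v) (v - Chat v) - m v v =
        m (Chat v) (Chat v) - 2 * m v (Chat v) := by
      simp only [map_sub, LinearMap.sub_apply]
      rw [hm (Chat v) v]
      ring
    have h₁ := abs_le.mp (hmsmall (Chat v) (Chat v) (hChat v))
    have h₂ := abs_le.mp (hmsmall v (Chat v) (hChat v))
    rw [hexp, abs_le]
    constructor <;> linarith [h₁.1, h₁.2, h₂.1, h₂.2]
  · have hbound : Real.sqrt (a (Chat v) (Chat v)) ≤ (1 + g + η) * Real.sqrt (a v v) := by
      have h₁ := sqrt_apply_sub_le a ha hpsd (C v) (C v - Ck v)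
      have h₂ := sqrt_apply_sub_le a ha hpsd (Ck v) (Ck v - Chat v)
      rw [sub_sub_cancel] at h₁ h₂
      linarith [hCstab v, hloc v, hoo v]
    calc
      _ ≤ δ * (((1 + g + η) * Real.sqrt (a v v)) ^ 2 +
          2 * ((1 + g + η) * Real.sqrt (a v v)) * Real.sqrt (a v v)) := by gcongr
      _ = _ := by ring
end
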